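/- Let $A$, $B$, $C$ be finite sets in a commutative group with $A$, $B$ non-empty, and let $h$ be a positive integer. Let $M = \max_{a \in A} |(\{a\} + hB) \setminus (C + (h-1)B)|$, assume $M \ge 1$, and let $\beta$ be the unique positive real satisfying $\prod_{r=0}^{h-1}(\beta + r) = h! \cdot M$. Then $|(A + hB) \setminus (C + (h-1)B)| \le \frac{M \cdot |(A+B) \setminus C|}{\beta}$. -/

import Mathlib

open Pointwise

/-- `iterSum B k` is the `k`-fold iterated sumset `B + ⋯ + B` (`k` times),
with the convention `iterSum B 0 = {0}`. -/
def iterSum {G : Type*} [AddCommGroup G] [DecidableEq G] (B : Finset G) : ℕ → Finset G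
  | 0 => {0}
  | k + 1 => iterSum B k + B

theorem mem_iterSum {G : Type*} [AddCommGroup G] [DecidableEq G] {B : Finset G} {k : ℕ} {x : G} :
    x ∈ iterSum B k ↔ ∃ m : Multiset G, m.card = k ∧ (∀ b ∈ m, b ∈ B) ∧ m.sum = x := by
  induction k generalizing x with
  | zero =>
    simp only [iterSum, Finset.mem_singleton, Multiset.card_eq_zero]
    constructor
    · rintro rfl
      exact ⟨0, by simp⟩
    · rintro ⟨m, rfl, -, rfl⟩
      simp
  | succ k ih =>
    simp only [iterSum, Finset.mem_add, ih]
    constructor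
    · rintro ⟨_, ⟨m, hm, hmB, rfl⟩, b, hb, rfl⟩
      refine ⟨b ::ₘ m, by simp [hm], ?_, by simp [add_comm]⟩
      simpa using ⟨hb, hmB⟩
    · rintro ⟨m, hm, hmB, rfl⟩
      obtain ⟨b, hb⟩ := Multiset.card_pos_iff_exists_mem.1 (by omega : 0 < m.card)
      obtain ⟨t, rfl⟩ := Multiset.exists_cons_of_mem hb
      simp only [Multiset.mem_cons, forall_eq_or_imp] at hmB
      exact ⟨t.sum, ⟨t, by simpa using hm, hmB.2, rfl⟩, b, hmB.1, by simp [add_comm]⟩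

theorem add_iterSum {G : Type*} [AddCommGroup G] [DecidableEq G] (B : Finset G) (k : ℕ) :
    B + iterSum B k = iterSum B (k + 1) :=
  add_comm _ _

theorem card_iterSum_le_multichoose {G : Type*} [AddCommGroup G] [DecidableEq G] (B : Finset G)
    (k : ℕ) : (iterSum B k).card ≤ B.card.multichoose k := by
  have hsub : iterSum B k ⊆
      (Finset.univ : Finset (Sym B k)).image fun s => (s.1.map Subtype.val).sum := by
    intro x hx
    obtain ⟨m, hm, hmB, rfl⟩ := mem_iterSum.1 hx
    lift m to Multiset B using hmB
    exact Finset.mem_image.2 ⟨⟨m, by simpa using hm⟩, Finset.mem_univ _, rfl⟩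
  calc (iterSum B k).card ≤ _ := Finset.card_le_card hsub
    _ ≤ _ := Finset.card_image_le
    _ = B.card.multichoose k := by
      rw [Finset.card_univ, Sym.card_sym_eq_multichoose, Fintype.card_coe]

/-- The top layer of a restricted addition graph with a single source is controlled by the
first layer. -/
theorem card_singleton_add_iterSum_sdiff_le {G : Type*} [AddCommGroup G] [DecidableEq G]
    (a : G) (B C : Finset G) (k : ℕ) :
    ((({a} : Finset G) + iterSum B (k + 1)) \ (C + iterSum B k)).card ≤
      ((({a} : Finset G) + B) \ C).card.multichoose (k + 1) := by
  set D := B.filter fun b => a + b ∉ C with hD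
  have hcard : ((({a} : Finset G) + B) \ C).card = D.card := by
    rw [← Finset.card_image_of_injective D (add_right_injective a)]
    congr 1
    ext x
    simp only [Finset.mem_sdiff, Finset.singleton_add, Finset.mem_image, hD,
      Finset.mem_filter, vadd_eq_add, Finset.mem_vadd_finset]
    grind
  have hsub : (({a} : Finset G) + iterSum B (k + 1)) \ (C + iterSum B k) ⊆
      (iterSum D (k + 1)).image (a + ·) := by
    intro x hx
    obtain ⟨hx, hxC⟩ := Finset.mem_sdiff.1 hx
    obtain ⟨a', ha', y, hy, rfl⟩ := Finset.mem_add.1 hx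
    obtain rfl := Finset.mem_singleton.1 ha'
    obtain ⟨m, hm, hmB, rfl⟩ := mem_iterSum.1 hy
    refine Finset.mem_image.2 ⟨m.sum, mem_iterSum.2 ⟨m, hm, fun b hb => ?_, rfl⟩, rfl⟩
    refine Finset.mem_filter.2 ⟨hmB b hb, fun hbC => hxC ?_⟩
    obtain ⟨t, rfl⟩ := Multiset.exists_cons_of_mem hb
    refine Finset.mem_add.2 ⟨a' + b, hbC, t.sum, mem_iterSum.2 ⟨t, by simpa using hm,
      fun c hc => hmB c (Multiset.mem_cons_of_mem hc), rfl⟩, by simp [add_assoc]⟩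
  rw [hcard]
  exact (Finset.card_le_card hsub).trans
    (Finset.card_image_le.trans (card_iterSum_le_multichoose D (k + 1)))

theorem prod_range_add_eq_factorial_mul_multichoose (d k : ℕ) :
    ∏ r ∈ Finset.range k, ((d : ℝ) + r) = (k.factorial : ℝ) * (d.multichoose k : ℝ) := by
  have := Nat.ascFactorial_eq_factorial_mul_choose' d k
  rw [← Nat.multichoose_eq, Nat.ascFactorial_eq_prod_range] at this
  exact_mod_cast this

/-- If `binom (β + k, k + 1) = M`, then the smaller of `M` and `binom (d + k, k + 1)` is at most
`M d / β`. -/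
theorem mul_le_mul_of_le_multichoose {d k m M : ℕ} {β : ℝ} (hβpos : 0 < β)
    (hβ : ∏ r ∈ Finset.range (k + 1), (β + r) = ((k + 1).factorial : ℝ) * (M : ℝ))
    (hmM : m ≤ M) (hmd : m ≤ d.multichoose (k + 1)) : (m : ℝ) * β ≤ M * d := by
  rcases le_total β d with hd | hd
  · have : (m : ℝ) ≤ M := by exact_mod_cast hmM
    gcongr
  · have hf : (0 : ℝ) < ((k + 1).factorial : ℝ) := by positivity
    have hmd' : (m : ℝ) ≤ (d.multichoose (k + 1) : ℝ) := by exact_mod_cast hmd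
    have hdprod := prod_range_add_eq_factorial_mul_multichoose d (k + 1)
    rw [Finset.prod_range_succ'] at hβ hdprod
    simp only [Nat.cast_zero, add_zero] at hβ hdprod
    have hle : ∏ r ∈ Finset.range k, ((d : ℝ) + (r + 1 : ℕ)) ≤
        ∏ r ∈ Finset.range k, (β + (r + 1 : ℕ)) := by
      gcongr
    refine le_of_mul_le_mul_left ?_ hf
    calc ((k + 1).factorial : ℝ) * (m * β)
        ≤ ((k + 1).factorial : ℝ) * (d.multichoose (k + 1) * β) := by gcongr
      _ = (∏ r ∈ Finset.range k, ((d : ℝ) + (r + 1 : ℕ))) * (d * β) := by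
        rw [← mul_assoc, ← hdprod]; ring
      _ ≤ (∏ r ∈ Finset.range k, (β + (r + 1 : ℕ))) * (d * β) := by gcongr
      _ = ((k + 1).factorial : ℝ) * (M * d) := by
        rw [← mul_assoc ((k + 1).factorial : ℝ), ← hβ]; ring

theorem card_add_iterSum_sdiff_mul_le {G : Type*} [AddCommGroup G] [DecidableEq G]
    (A B C : Finset G) (k M : ℕ)
    (hM : ∀ a ∈ A,
      ((({a} : Finset G) + iterSum B (k + 1)) \ (C + iterSum B k)).card ≤ M)
    {β : ℝ} (hβpos : 0 < β)
    (hβ : ∏ r ∈ Finset.range (k + 1), (β + r) = ((k + 1).factorial : ℝ) * (M : ℝ)) :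
    (((A + iterSum B (k + 1)) \ (C + iterSum B k)).card : ℝ) * β ≤
      M * (((A + B) \ C).card : ℝ) := by
  induction A using Finset.induction_on with
  | empty => simp
  | insert a A _ ih =>
    have split (X Y Z : Finset G) : ((X ∪ Y) \ Z).card = (Y \ Z).card + (X \ (Z ∪ Y)).card := by
      rw [← Finset.card_union_of_disjoint]
      · congr 1; ext; simp only [Finset.mem_sdiff, Finset.mem_union]; tauto
      · rw [Finset.disjoint_left]; simp only [Finset.mem_sdiff, Finset.mem_union]; tauto
    have hC : (C + iterSum B k) ∪ (A + iterSum B (k + 1)) = (C ∪ (A + B)) + iterSum B k := by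
      rw [Finset.union_add, add_assoc, add_iterSum]
    have hsource : ((({a} : Finset G) + iterSum B (k + 1)) \
        ((C ∪ (A + B)) + iterSum B k)).card ≤ M :=
      (Finset.card_le_card (Finset.sdiff_subset_sdiff subset_rfl
        (Finset.add_subset_add_right Finset.subset_union_left))).trans
        (hM a (Finset.mem_insert_self a A))
    have hnew := mul_le_mul_of_le_multichoose hβpos hβ hsource
      (card_singleton_add_iterSum_sdiff_le a B (C ∪ (A + B)) k)
    have hold := ih fun a' ha' => hM a' (Finset.mem_insert_of_mem ha')
    rw [Finset.insert_eq, Finset.union_add, Finset.union_add, split, split, hC]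
    push_cast
    linarith

/-- Growth of commutative graphs, instantiated on the restricted addition graph
`G_R(A, B, C)`: with `M` the maximal cardinality of the image in the top layer of a
one-element set, and `β` defined by `∏_{r=0}^{h-1} (β + r) = h! · M`, one has
`|(A + hB) \ (C + (h-1)B)| ≤ M · |(A+B) \ C| / β`. -/
theorem stmt_13 {G : Type*} [AddCommGroup G] [DecidableEq G]
    (A B C : Finset G) (hA : A.Nonempty) (hB : B.Nonempty)
    (h : ℕ) (hh : 0 < h) (M : ℕ) (hM1 : 1 ≤ M)
    (hMub : ∀ a ∈ A,
      ((({a} : Finset G) + iterSum B h) \ (C + iterSum B (h - 1))).card ≤ M)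
    (hMmem : ∃ a ∈ A,
      ((({a} : Finset G) + iterSum B h) \ (C + iterSum B (h - 1))).card = M)
    (β : ℝ) (hβpos : 0 < β)
    (hβ : ∏ r ∈ Finset.range h, (β + r) = (Nat.factorial h : ℝ) * (M : ℝ)) :
    (((A + iterSum B h) \ (C + iterSum B (h - 1))).card : ℝ) ≤
      (M : ℝ) * (((A + B) \ C).card : ℝ) / β := by
  obtain ⟨k, rfl⟩ := Nat.exists_eq_succ_of_ne_zero hh.ne'
  rw [le_div_iff₀ hβpos]
  exact card_add_iterSum_sdiff_mul_le A B C k M hMub hβpos hβ
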